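/- Under the standing hypotheses, a + 3d cannot be written in the 2-weak dominated form: there is no nonnegative integer x such that a + 3d = 3^x + 2^{n-1}. -/

import Mathlib

/-- `u` is one of `729 * b`, `243 * b`, ..., `3 * b` or at most `b`. -/
def ThreeLevel (b u : ℤ) : Prop :=
  u = 729 * b ∨ u = 243 * b ∨ u = 81 * b ∨ u = 27 * b ∨ u = 9 * b ∨ u = 3 * b ∨ u ≤ b

/-- `v` is one of `64 * c`, `32 * c`, ..., `2 * c` or at most `c`. -/
def TwoLevel (c v : ℤ) : Prop :=
  v = 64 * c ∨ v = 32 * c ∨ v = 16 * c ∨ v = 8 * c ∨ v = 4 * c ∨ v = 2 * c ∨ v ≤ c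

/-- A power of `3` below `3 ^ (j + 7)` is one of the six largest ones or at most `3 ^ j`. -/
theorem three_pow_eq_or_le {j x : ℕ} (h : 3 ^ x < 3 ^ (j + 7)) :
    3 ^ x = 729 * 3 ^ j ∨ 3 ^ x = 243 * 3 ^ j ∨ 3 ^ x = 81 * 3 ^ j ∨ 3 ^ x = 27 * 3 ^ j ∨
      3 ^ x = 9 * 3 ^ j ∨ 3 ^ x = 3 * 3 ^ j ∨ 3 ^ x ≤ 3 ^ j := by
  have hx : x < j + 7 := (Nat.pow_lt_pow_iff_right (by norm_num)).1 h
  rcases Nat.lt_or_ge j x with hj | hj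
  · obtain ⟨i, rfl⟩ := Nat.exists_eq_add_of_lt hj
    have hi : i < 6 := by omega
    interval_cases i <;> simp only [pow_add] <;> omega
  · have := Nat.pow_le_pow_right (n := 3) (by norm_num) hj
    omega

/-- A power of `2` below `2 ^ (k + 7)` is one of the six largest ones or at most `2 ^ k`. -/
theorem two_pow_eq_or_le {k y : ℕ} (h : 2 ^ y < 2 ^ (k + 7)) :
    2 ^ y = 64 * 2 ^ k ∨ 2 ^ y = 32 * 2 ^ k ∨ 2 ^ y = 16 * 2 ^ k ∨ 2 ^ y = 8 * 2 ^ k ∨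
      2 ^ y = 4 * 2 ^ k ∨ 2 ^ y = 2 * 2 ^ k ∨ 2 ^ y ≤ 2 ^ k := by
  have hy : y < k + 7 := (Nat.pow_lt_pow_iff_right (by norm_num)).1 h
  rcases Nat.lt_or_ge k y with hk | hk
  · obtain ⟨i, rfl⟩ := Nat.exists_eq_add_of_lt hk
    have hi : i < 6 := by omega
    interval_cases i <;> simp only [pow_add] <;> omega
  · have := Nat.pow_le_pow_right (n := 2) (by norm_num) hk
    omega

theorem two_pow_mod_three (y : ℕ) : 2 ^ y % 3 = 1 ∨ 2 ^ y % 3 = 2 := by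
  induction y with
  | zero => simp
  | succ y ih => rw [pow_succ]; omega

theorem ThreeLevel.eq_or_eq_or_le {b u : ℤ} (hb : 0 < b) (h : ThreeLevel b u) :
    u = 729 * b ∨ u = 243 * b ∨ u ≤ 81 * b := by
  unfold ThreeLevel at h; omega

theorem TwoLevel.eq_or_eq_or_le {c v : ℤ} (hc : 0 < c) (h : TwoLevel c v) :
    v = 64 * c ∨ v = 32 * c ∨ v ≤ 16 * c := by
  unfold TwoLevel at h; omega

/-- `t` is the sum of one of the dominating terms `729 * b`, `64 * c` and a smaller positive
term of the other kind. -/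
def Dominated (b c t : ℤ) : Prop :=
  (∃ v, t = 729 * b + v ∧ 0 < v ∧ v ≤ 64 * c ∧ TwoLevel c v) ∨
    ∃ u, t = 64 * c + u ∧ 0 < u ∧ u ≤ 729 * b ∧ ThreeLevel b u

theorem dominated_or_eq {b c t N u v : ℤ} (hb : 0 < b) (hc : 0 < c) (hbN : 729 * b ≤ N)
    (hcN : 64 * c ≤ N) (ht : t = u + v) (hu : 0 < u) (hv : 0 < v)
    (hlu : ThreeLevel b u) (hlv : TwoLevel c v) (h : 2 * N < 3 * t) :
    Dominated b c t ∨ t = 243 * b + 32 * c := by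
  rcases hlu.eq_or_eq_or_le hb with rfl | rfl | hu'
  · exact .inl (.inl ⟨v, ht, hv, by have := hlv.eq_or_eq_or_le hc; omega, hlv⟩)
  all_goals
    rcases hlv.eq_or_eq_or_le hc with rfl | rfl | hv'
    · exact .inl (.inr ⟨_, by linarith, hu, by linarith, hlu⟩)
    · first
      | exact .inr ht
      | exact absurd h (by linarith)
    · exact absurd h (by linarith)

/-! Assume `a + 6 * d` lies in `[729 * b, 2187 * b)` and in `[64 * c, 128 * c)`, as happens for
`b = 3 ^ (m - 6)` and `c = 2 ^ (n - 6)`. The following lemmas exclude `a + 3 * d = u₃ + 32 * c`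
according to the size of `u₃` and the shape of `a + 4 * d`. -/

section Progression

variable {a d b c u₃ : ℤ}

set_option maxHeartbeats 2000000 in
theorem not_dominated_of_le (ha : 0 < a) (hd : 0 < d) (hb : 0 < b)
    (hc₃ : c % 3 ≠ 0 ∧ b % 3 = 0)
    (hm₁ : 729 * b ≤ a + 6 * d) (hm₂ : a + 6 * d < 2187 * b)
    (hn₁ : 64 * c ≤ a + 6 * d) (hn₂ : a + 6 * d < 128 * c)
    (h₃ : a + 3 * d = u₃ + 32 * c) (hu₃ : 0 < u₃) (hu₃' : u₃ = 243 * b ∨ u₃ ≤ 81 * b)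
    (h₄ : Dominated b c (a + 4 * d)) (h₅ : Dominated b c (a + 5 * d))
    (h₆ : Dominated b c (a + 6 * d)) : False := by
  obtain rfl : a = u₃ + 32 * c - 3 * d := by linarith
  clear h₃
  revert hc₃
  rcases h₄ with ⟨e, h₄, p₄, q₄, l₄⟩ | ⟨e, h₄, p₄, q₄, l₄⟩ <;>
  rcases h₅ with ⟨f, h₅, p₅, q₅, l₅⟩ | ⟨f, h₅, p₅, q₅, l₅⟩ <;>
  rcases h₆ with ⟨g, h₆, p₆, q₆, l₆⟩ | ⟨g, h₆, p₆, q₆, l₆⟩ <;>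
  rcases hu₃' with rfl | hu₃' <;>
  try (exfalso; linarith)
  all_goals
    rcases l₄ with rfl | rfl | rfl | rfl | rfl | rfl | l₄ <;>
    try (exfalso; linarith)
  all_goals
    rcases l₅ with rfl | rfl | rfl | rfl | rfl | rfl | l₅ <;>
    try (exfalso; linarith)
  all_goals
    rcases l₆ with rfl | rfl | rfl | rfl | rfl | rfl | l₆ <;>
    try (exfalso; linarith)
  all_goals
    intro hc₃
    omega

theorem not_dominated_of_middle (ha : 0 < a) (hd : 0 < d) (hb : 0 < b) (hc : 0 < c)
    (hm₁ : 729 * b ≤ a + 6 * d) (hm₂ : a + 6 * d < 2187 * b) (hn₁ : 64 * c ≤ a + 6 * d)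
    (h₃ : a + 3 * d = u₃ + 32 * c) (hu₃ : 0 < u₃) (l₃ : ThreeLevel b u₃)
    (h₄ : a + 4 * d = 243 * b + 32 * c) (h₅ : Dominated b c (a + 5 * d))
    (h₆ : Dominated b c (a + 6 * d)) : False := by
  rcases h₅ with ⟨f, h₅, p₅, q₅, l₅⟩ | ⟨f, h₅, p₅, q₅, l₅⟩ <;>
  rcases h₆ with ⟨g, h₆, p₆, q₆, l₆⟩ | ⟨g, h₆, p₆, q₆, l₆⟩ <;>
  rcases l₃ with rfl | rfl | rfl | rfl | rfl | rfl | l₃ <;>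
  try (exfalso; linarith)
  all_goals
    rcases l₅ with rfl | rfl | rfl | rfl | rfl | rfl | l₅ <;>
    try (exfalso; linarith)
  all_goals
    rcases l₆ with rfl | rfl | rfl | rfl | rfl | rfl | l₆ <;>
    linarith

theorem not_dominated_of_top {u₄ u₅ u₆ v₄ v₅ v₆ : ℤ}
    (ha : 0 < a) (hd : 0 < d) (hb : 0 < b) (hc : 0 < c)
    (hn₂ : a + 6 * d < 128 * c)
    (h₃ : a + 3 * d = 729 * b + 32 * c) (h₄ : a + 4 * d = u₄ + v₄)
    (h₅ : a + 5 * d = u₅ + v₅) (h₆ : a + 6 * d = u₆ + v₆)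
    (p₄ : 0 < u₄) (p₅ : 0 < u₅) (p₆ : 0 < u₆)
    (l₄ : ThreeLevel b u₄) (l₅ : ThreeLevel b u₅) (l₆ : ThreeLevel b u₆)
    (r₄ : TwoLevel c v₄) (r₅ : TwoLevel c v₅) (r₆ : TwoLevel c v₆)
    (hgap : u₅ < u₆ → 3 * u₅ ≤ u₆) : False := by
  rcases r₄.eq_or_eq_or_le hc with rfl | r₄ | r₄ <;>
  rcases l₄.eq_or_eq_or_le hb with rfl | l₄ | l₄ <;>
  try (exfalso; linarith)
  all_goals
    rcases r₅.eq_or_eq_or_le hc with rfl | r₅ | r₅ <;>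
    rcases l₅.eq_or_eq_or_le hb with rfl | l₅ | l₅ <;>
    try (exfalso; linarith)
  all_goals
    rcases r₆.eq_or_eq_or_le hc with rfl | r₆ | r₆ <;>
    rcases l₆.eq_or_eq_or_le hb with rfl | l₆ | l₆ <;>
    try (exfalso; linarith)
  all_goals
    linarith [hgap (by linarith)]

end Progression

/-- Under the standing hypotheses, a + 3d is not of the 2-weak dominated form 3^x + 2^(n-1). -/
theorem a4_not_2_weak_dominated (a d m n : ℕ)
    (ha : 0 < a) (hd : 0 < d)
    (hAP : ∀ i : ℕ, i ≤ 6 → ∃ x y : ℕ, a + i * d = 3 ^ x + 2 ^ y)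
    (hbig : 3 ^ 9 ≤ a + 6 * d)
    (hm₁ : 3 ^ m ≤ a + 6 * d) (hm₂ : a + 6 * d < 3 ^ (m + 1))
    (hn₁ : 2 ^ n ≤ a + 6 * d) (hn₂ : a + 6 * d < 2 ^ (n + 1)) :
    ¬ ∃ x : ℕ, a + 3 * d = 3 ^ x + 2 ^ (n - 1) := by
  rintro ⟨x₃, h₃⟩
  obtain ⟨x₄, y₄, h₄⟩ := hAP 4 (by norm_num)
  obtain ⟨x₅, y₅, h₅⟩ := hAP 5 (by norm_num)
  obtain ⟨x₆, y₆, h₆⟩ := hAP 6 (by norm_num)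
  have hm : 9 < m + 1 :=
    (Nat.pow_lt_pow_iff_right (a := 3) (by norm_num)).1 (hbig.trans_lt hm₂)
  have hn : 14 < n + 1 :=
    (Nat.pow_lt_pow_iff_right (a := 2) (by norm_num)).1
      (lt_of_le_of_lt (le_trans (by norm_num) hbig) hn₂)
  obtain ⟨j, rfl⟩ : ∃ j, m = j + 6 := ⟨m - 6, by omega⟩
  obtain ⟨k, rfl⟩ : ∃ k, n = k + 6 := ⟨n - 6, by omega⟩
  have pos3 (x : ℕ) : 0 < 3 ^ x := by positivity
  have pos2 (y : ℕ) : 0 < 2 ^ y := by positivity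
  have p₄ := pos3 x₄
  have p₅ := pos3 x₅
  have p₆ := pos3 x₆
  have q₄ := pos2 y₄
  have q₅ := pos2 y₅
  have q₆ := pos2 y₆
  rw [show j + 6 + 1 = j + 7 from rfl] at hm₂
  rw [show k + 6 + 1 = k + 7 from rfl] at hn₂
  have l₃ := three_pow_eq_or_le (show 3 ^ x₃ < 3 ^ (j + 7) by linarith [pos2 (k + 6 - 1)])
  have l₄ := three_pow_eq_or_le (show 3 ^ x₄ < 3 ^ (j + 7) by linarith)
  have l₅ := three_pow_eq_or_le (show 3 ^ x₅ < 3 ^ (j + 7) by linarith)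
  have l₆ := three_pow_eq_or_le (show 3 ^ x₆ < 3 ^ (j + 7) by linarith)
  have r₄ := two_pow_eq_or_le (show 2 ^ y₄ < 2 ^ (k + 7) by linarith)
  have r₅ := two_pow_eq_or_le (show 2 ^ y₅ < 2 ^ (k + 7) by linarith)
  have r₆ := two_pow_eq_or_le (show 2 ^ y₆ < 2 ^ (k + 7) by linarith)
  have cj := pos3 j
  have ck := pos2 k
  have ej : 3 ^ j % 3 = 0 := by
    obtain ⟨i, rfl⟩ : ∃ i, j = i + 1 := ⟨j - 1, by omega⟩
    rw [pow_succ]; omega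
  have fk : 2 ^ k % 3 ≠ 0 := by have := two_pow_mod_three k; omega
  have gap : 3 ^ x₅ < 3 ^ x₆ → 3 * 3 ^ x₅ ≤ 3 ^ x₆ := by
    intro h
    rw [← pow_succ']
    exact Nat.pow_le_pow_right (by norm_num) ((Nat.pow_lt_pow_iff_right (by norm_num)).1 h)
  simp only [show k + 6 - 1 = k + 5 by omega, pow_add] at h₃ hm₁ hm₂ hn₁ hn₂
  zify at *
  replace h₃ : (a : ℤ) + 3 * d = 3 ^ x₃ + 32 * 2 ^ k := by linarith
  replace hm₁ : (729 : ℤ) * 3 ^ j ≤ a + 6 * d := by linarith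
  replace hm₂ : (a : ℤ) + 6 * d < 2187 * 3 ^ j := by linarith
  replace hn₁ : (64 : ℤ) * 2 ^ k ≤ a + 6 * d := by linarith
  replace hn₂ : (a : ℤ) + 6 * d < 128 * 2 ^ k := by linarith
  have f₆ := dominated_or_eq cj ck hm₁ hn₁ h₆ p₆ q₆ l₆ r₆ (by linarith)
  have f₅ := dominated_or_eq cj ck hm₁ hn₁ h₅ p₅ q₅ l₅ r₅ (by linarith)
  have f₄ := dominated_or_eq cj ck hm₁ hn₁ h₄ p₄ q₄ l₄ r₄ (by linarith)
  replace f₆ := f₆.resolve_right fun h => by linarith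
  replace f₅ := f₅.resolve_right fun h => by linarith
  rcases f₄ with f₄ | f₄
  · rcases ThreeLevel.eq_or_eq_or_le cj l₃ with e₃ | e₃
    · rw [e₃] at h₃
      exact not_dominated_of_top ha hd cj ck hn₂ h₃ h₄ h₅ h₆ p₄ p₅ p₆ l₄ l₅ l₆ r₄ r₅ r₆ gap
    · exact not_dominated_of_le ha hd cj ⟨fk, ej⟩ hm₁ hm₂ hn₁ hn₂ h₃ (pos3 x₃) e₃ f₄ f₅ f₆
  · exact not_dominated_of_middle ha hd cj ck hm₁ hm₂ hn₁ h₃ (pos3 x₃) l₃ f₄ f₅ f₆
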